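/- Let Φ be a finite NCIFS that is subexponentially bounded (lim (1/n) log #I^(n) = 0) and weakly balanced (lim (1/n) log ρ_n = 0, where ρ_n is the maximal ratio of derivative norms at level n). Then Bowen's formula holds: HD(J(Φ)) = B(Φ). -/

import Mathlib

open Metric Set Filter Topology MeasureTheory
open scoped ENNReal

noncomputable section

/-- A non-autonomous conformal iterated function system (NCIFS) on a compact subset `X` of
`ℝ^d`, encoded via the composed maps `wMap m n ω` associated with finite words `ω` occupying
levels `m, m+1, …, n-1`, together with their conformal derivative norms `segN m n ω = ‖Dφ_ω‖`.
The fields record the standing assumptions: the open set condition, bounded distortion with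
constant `K` (both for derivative norms of split words and as two-sided Lipschitz bounds),
and uniform contraction with constant `η < 1`. -/
structure NCIFS (d : ℕ) where
  X : Set (EuclideanSpace ℝ (Fin d))
  hX_compact : IsCompact X
  hX_nonempty : X.Nonempty
  hX_regular : closure (interior X) = X
  hX_convex : Convex ℝ X
  I : ℕ → Type
  hI_ne : ∀ n, Nonempty (I n)
  K : ℝ
  hK : 1 ≤ K
  η : ℝ
  hη_pos : 0 < η
  hη_lt : η < 1
  /-- `segN m n ω` is the derivative norm `‖Dφ_ω‖` of the word `ω` on levels `m, …, n-1`. -/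
  segN : (m n : ℕ) → ((j : Finset.Ico m n) → I j) → ℝ
  segN_pos : ∀ m n ω, 0 < segN m n ω
  /-- uniform contraction -/
  segN_contract : ∀ m n ω, segN m n ω ≤ η ^ (n - m)
  /-- submultiplicativity and bounded distortion for derivative norms of split words -/
  segN_split : ∀ m k n, m ≤ k → k ≤ n →
      ∀ (ω : (j : Finset.Ico m n) → I j) (ω₁ : (j : Finset.Ico m k) → I j)
        (ω₂ : (j : Finset.Ico k n) → I j),
        (∀ (j : ℕ) (h₁ : j ∈ Finset.Ico m k) (h₂ : j ∈ Finset.Ico m n),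
            ω₁ ⟨j, h₁⟩ = ω ⟨j, h₂⟩) →
        (∀ (j : ℕ) (h₁ : j ∈ Finset.Ico k n) (h₂ : j ∈ Finset.Ico m n),
            ω₂ ⟨j, h₁⟩ = ω ⟨j, h₂⟩) →
        segN m n ω ≤ segN m k ω₁ * segN k n ω₂ ∧
          segN m k ω₁ * segN k n ω₂ ≤ K * segN m n ω
  /-- the conformal contraction associated to the word `ω` on levels `m, …, n-1` -/
  wMap : (m n : ℕ) → ((j : Finset.Ico m n) → I j) →
      EuclideanSpace ℝ (Fin d) → EuclideanSpace ℝ (Fin d)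
  wMap_id : ∀ m (ω : (j : Finset.Ico m m) → I j) x, wMap m m ω x = x
  wMap_mapsTo : ∀ m n ω, MapsTo (wMap m n ω) X X
  /-- upper conformal bound: `φ_ω` is `‖Dφ_ω‖`-Lipschitz on `X` -/
  wMap_lip : ∀ m n ω, ∀ x ∈ X, ∀ y ∈ X,
      dist (wMap m n ω x) (wMap m n ω y) ≤ segN m n ω * dist x y
  /-- lower conformal bound (bounded distortion) -/
  wMap_colip : ∀ m n ω, ∀ x ∈ X, ∀ y ∈ X,
      segN m n ω / K * dist x y ≤ dist (wMap m n ω x) (wMap m n ω y)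
  /-- compatibility of the maps under splitting of words -/
  wMap_comp : ∀ m k n, m ≤ k → k ≤ n →
      ∀ (ω : (j : Finset.Ico m n) → I j) (ω₁ : (j : Finset.Ico m k) → I j)
        (ω₂ : (j : Finset.Ico k n) → I j),
        (∀ (j : ℕ) (h₁ : j ∈ Finset.Ico m k) (h₂ : j ∈ Finset.Ico m n),
            ω₁ ⟨j, h₁⟩ = ω ⟨j, h₂⟩) →
        (∀ (j : ℕ) (h₁ : j ∈ Finset.Ico k n) (h₂ : j ∈ Finset.Ico m n),
            ω₂ ⟨j, h₁⟩ = ω ⟨j, h₂⟩) →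
        ∀ x ∈ X, wMap m n ω x = wMap m k ω₁ (wMap k n ω₂ x)
  /-- the open set condition -/
  osc : ∀ n (a b : (j : Finset.Ico n (n+1)) → I j), a ≠ b →
      Disjoint (wMap n (n+1) a '' interior X) (wMap n (n+1) b '' interior X)

namespace NCIFS

variable {d : ℕ} (Φ : NCIFS d)

/-- Words occupying levels `m, …, n-1`. -/
abbrev Word (m n : ℕ) := (j : Finset.Ico m n) → Φ.I j

instance (m n : ℕ) : Nonempty (Φ.Word m n) :=
  ⟨fun j => Classical.choice (Φ.hI_ne j)⟩

/-- The one-letter word at level `n` given by the index `i`. -/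
def single (n : ℕ) (i : Φ.I n) : Φ.Word n (n+1) :=
  fun j => cast (congrArg Φ.I (show n = (j : ℕ) by
    have := Finset.mem_Ico.mp j.2; omega)) i

/-- `‖Dφ_i^{(n)}‖`, the derivative norm of the single map with index `i` at level `n`. -/
def Dnorm (n : ℕ) (i : Φ.I n) : ℝ := Φ.segN n (n+1) (Φ.single n i)

/-- The partition function `Z_n(t) = Σ_{ω ∈ I^n} ‖Dφ_ω‖^t`, valued in `[0,∞]`. -/
def Z (n : ℕ) (t : ℝ) : ℝ≥0∞ := ∑' ω : Φ.Word 0 n, ENNReal.ofReal (Φ.segN 0 n ω ^ t)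

/-- The lower pressure `P̲(t) = liminf (1/n) log Z_n(t)`, valued in `[-∞,∞]`. -/
def lowP (t : ℝ) : EReal :=
  liminf (fun n : ℕ => (Φ.Z n t).log * (((n : ℝ)⁻¹ : ℝ) : EReal)) atTop

/-- The upper pressure `P̄(t) = limsup (1/n) log Z_n(t)`. -/
def upP (t : ℝ) : EReal :=
  limsup (fun n : ℕ => (Φ.Z n t).log * (((n : ℝ)⁻¹ : ℝ) : EReal)) atTop

/-- The Bowen dimension `B(Φ) = sup {t ≥ 0 : P̲(t) > 0}` (and `0` if there is no such `t`). -/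
def Bdim : ℝ≥0∞ := ⨆ t : {t : ℝ // 0 ≤ t ∧ (0 : EReal) < Φ.lowP t}, ENNReal.ofReal t.1

/-- The limit set `J(Φ) = ⋂_n ⋃_{ω ∈ I^n} φ_ω(X)`. -/
def limitSet : Set (EuclideanSpace ℝ (Fin d)) :=
  ⋂ n, ⋃ ω : Φ.Word 0 n, Φ.wMap 0 n ω '' Φ.X

/-- The minimal derivative norm `c̲_n` at level `n`. -/
def cmin (n : ℕ) : ℝ := ⨅ i : Φ.I n, Φ.Dnorm n i

/-- The maximal derivative norm `c̄_n` at level `n`. -/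
def cmax (n : ℕ) : ℝ := ⨆ i : Φ.I n, Φ.Dnorm n i

/-- `ρ_n`, the maximal ratio of derivative norms at level `n`. -/
def ρ (n : ℕ) : ℝ := Φ.cmax n / Φ.cmin n

/-- The modified partition function
`Z̃_n(t) = Z_{n-1}(t) · (#I^{(n)})^{t/d} · c̲_n^t`. -/
def Zt (n : ℕ) (t : ℝ) : ℝ≥0∞ :=
  Φ.Z (n - 1) t * ENNReal.ofReal ((Nat.card (Φ.I n) : ℝ) ^ (t / (d : ℝ)) * Φ.cmin n ^ t)

/-- `P̃(t) = liminf (1/n) log Z̃_n(t)`. -/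
def tP (t : ℝ) : EReal :=
  liminf (fun n : ℕ => (Φ.Zt n t).log * (((n : ℝ)⁻¹ : ℝ) : EReal)) atTop

end NCIFS

namespace NCIFS

section Helpers

variable {d : ℕ} (Φ : NCIFS d)

/-- Restriction of a word to a smaller range of levels. -/
def res {m n : ℕ} (m' n' : ℕ) (h₁ : m ≤ m') (h₂ : n' ≤ n) (ω : Φ.Word m n) : Φ.Word m' n' :=
  fun j => ω ⟨j, Finset.Ico_subset_Ico h₁ h₂ j.2⟩

lemma res_split {m n : ℕ} (k : ℕ) (h₁ : m ≤ k) (h₂ : k ≤ n) (ω : Φ.Word m n) :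
    Φ.segN m n ω ≤ Φ.segN m k (Φ.res m k le_rfl h₂ ω) * Φ.segN k n (Φ.res k n h₁ le_rfl ω) ∧
    Φ.segN m k (Φ.res m k le_rfl h₂ ω) * Φ.segN k n (Φ.res k n h₁ le_rfl ω)
      ≤ Φ.K * Φ.segN m n ω :=
  Φ.segN_split m k n h₁ h₂ ω _ _ (fun _ _ _ => rfl) (fun _ _ _ => rfl)

lemma res_comp {m n : ℕ} (k : ℕ) (h₁ : m ≤ k) (h₂ : k ≤ n) (ω : Φ.Word m n)
    {x : EuclideanSpace ℝ (Fin d)} (hx : x ∈ Φ.X) :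
    Φ.wMap m n ω x = Φ.wMap m k (Φ.res m k le_rfl h₂ ω) (Φ.wMap k n (Φ.res k n h₁ le_rfl ω) x) :=
  Φ.wMap_comp m k n h₁ h₂ ω _ _ (fun _ _ _ => rfl) (fun _ _ _ => rfl) x hx

lemma image_res_subset {m n : ℕ} (k : ℕ) (h₁ : m ≤ k) (h₂ : k ≤ n) (ω : Φ.Word m n) :
    Φ.wMap m n ω '' Φ.X ⊆ Φ.wMap m k (Φ.res m k le_rfl h₂ ω) '' Φ.X := by
  rintro _ ⟨x, hx, rfl⟩
  rw [Φ.res_comp k h₁ h₂ ω hx]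
  exact mem_image_of_mem _ (Φ.wMap_mapsTo _ _ _ hx)

/-- Concatenation of words. -/
def cat {m k n : ℕ} (α : Φ.Word m k) (τ : Φ.Word k n) : Φ.Word m n :=
  fun j => if h : (j : ℕ) < k then α ⟨j, by have := Finset.mem_Ico.1 j.2; simp; omega⟩
    else τ ⟨j, by have := Finset.mem_Ico.1 j.2; simp; omega⟩

lemma res_cat_left {m k n : ℕ} (h₂ : k ≤ n) (α : Φ.Word m k) (τ : Φ.Word k n) :
    Φ.res m k le_rfl h₂ (Φ.cat α τ) = α := by
  funext j
  have := Finset.mem_Ico.1 j.2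
  simp [res, cat, this.2]

lemma res_cat_right {m k n : ℕ} (h₁ : m ≤ k) (α : Φ.Word m k) (τ : Φ.Word k n) :
    Φ.res k n h₁ le_rfl (Φ.cat α τ) = τ := by
  funext j
  have := Finset.mem_Ico.1 j.2
  simp [res, cat, not_lt.2 this.1]

lemma cat_res {m k n : ℕ} (h₁ : m ≤ k) (h₂ : k ≤ n) (ω : Φ.Word m n) :
    Φ.cat (Φ.res m k le_rfl h₂ ω) (Φ.res k n h₁ le_rfl ω) = ω := by
  funext j
  simp only [res, cat]
  split_ifs <;> rfl

/-- Splitting of words. -/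
def splitEquiv {m k n : ℕ} (h₁ : m ≤ k) (h₂ : k ≤ n) :
    Φ.Word m n ≃ Φ.Word m k × Φ.Word k n where
  toFun ω := (Φ.res m k le_rfl h₂ ω, Φ.res k n h₁ le_rfl ω)
  invFun p := Φ.cat p.1 p.2
  left_inv ω := Φ.cat_res h₁ h₂ ω
  right_inv p := by simp [res_cat_left, res_cat_right]

lemma res_res {m n : ℕ} {a b a' b' : ℕ} (h₁ : m ≤ a) (h₂ : b ≤ n) (h₃ : a ≤ a') (h₄ : b' ≤ b)
    (ω : Φ.Word m n) : Φ.res a' b' h₃ h₄ (Φ.res a b h₁ h₂ ω)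
      = Φ.res a' b' (h₁.trans h₃) (h₄.trans h₂) ω := rfl

lemma res_self {m n : ℕ} (ω : Φ.Word m n) : Φ.res m n le_rfl le_rfl ω = ω := rfl

lemma segN_empty (m : ℕ) (ω : Φ.Word m m) : 1 ≤ Φ.segN m m ω := by
  have := (Φ.res_split m le_rfl le_rfl ω).1
  rw [res_self] at this
  have h := Φ.segN_pos m m ω
  by_contra hc
  nlinarith

variable [∀ n, Finite (Φ.I n)]

instance wordFintype (m n : ℕ) : Fintype (Φ.Word m n) := Fintype.ofFinite _

/-- Real valued partition function. -/
def Zr (m n : ℕ) (t : ℝ) : ℝ := ∑ ω : Φ.Word m n, Φ.segN m n ω ^ t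

lemma Zr_pos (m n : ℕ) (t : ℝ) : 0 < Φ.Zr m n t :=
  Finset.sum_pos (fun ω _ => Real.rpow_pos_of_pos (Φ.segN_pos m n ω) t) Finset.univ_nonempty

lemma Z_eq (n : ℕ) (t : ℝ) : Φ.Z n t = ENNReal.ofReal (Φ.Zr 0 n t) := by
  rw [Z, Zr, tsum_fintype, ENNReal.ofReal_sum_of_nonneg]
  exact fun ω _ => Real.rpow_nonneg (Φ.segN_pos 0 n ω).le t

lemma Z_log (n : ℕ) (t : ℝ) : (Φ.Z n t).log * (((n : ℝ)⁻¹ : ℝ) : EReal)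
    = ((Real.log (Φ.Zr 0 n t) * (n : ℝ)⁻¹ : ℝ) : EReal) := by
  rw [Z_eq, ENNReal.log_ofReal_of_pos (Φ.Zr_pos 0 n t), EReal.coe_mul]

/-- Sum over a cylinder. -/
lemma cyl_le {m n : ℕ} (h : m ≤ n) {t : ℝ} (ht : 0 ≤ t) (α : Φ.Word 0 m) :
    ∑ τ : Φ.Word m n, Φ.segN 0 n (Φ.cat α τ) ^ t ≤ Φ.segN 0 m α ^ t * Φ.Zr m n t := by
  rw [Zr, Finset.mul_sum]
  refine Finset.sum_le_sum fun τ _ => ?_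
  rw [← Real.mul_rpow (Φ.segN_pos _ _ _).le (Φ.segN_pos _ _ _).le]
  refine Real.rpow_le_rpow (Φ.segN_pos _ _ _).le ?_ ht
  have := (Φ.res_split m (Nat.zero_le m) h (Φ.cat α τ)).1
  rwa [res_cat_left, res_cat_right] at this

lemma Zr_mul_le {m n : ℕ} (h : m ≤ n) {t : ℝ} (ht : 0 ≤ t) :
    Φ.Zr 0 m t * Φ.Zr m n t ≤ Φ.K ^ t * Φ.Zr 0 n t := by
  have hK : 0 ≤ Φ.K := zero_le_one.trans Φ.hK
  have e : Φ.Zr 0 n t = ∑ p : Φ.Word 0 m × Φ.Word m n, Φ.segN 0 n (Φ.cat p.1 p.2) ^ t :=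
    ((Φ.splitEquiv (Nat.zero_le m) h).symm.sum_comp (fun ω => Φ.segN 0 n ω ^ t)).symm
  rw [e, Zr, Zr, Finset.sum_mul_sum, Finset.mul_sum, Fintype.sum_prod_type]
  refine Finset.sum_le_sum fun α _ => Finset.sum_le_sum fun τ _ => ?_
  rw [← Real.mul_rpow (Φ.segN_pos _ _ _).le (Φ.segN_pos _ _ _).le,
    ← Real.mul_rpow hK (Φ.segN_pos _ _ _).le]
  refine Real.rpow_le_rpow (mul_pos (Φ.segN_pos _ _ _) (Φ.segN_pos _ _ _)).le ?_ ht
  have := (Φ.res_split m (Nat.zero_le m) h (Φ.cat α τ)).2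
  rwa [res_cat_left, res_cat_right] at this

open Classical in
lemma cyl_bound {m n : ℕ} (h : m ≤ n) {t : ℝ} (ht : 0 ≤ t) (α : Φ.Word 0 m) :
    ∑ ω : Φ.Word 0 n with Φ.res 0 m le_rfl h ω = α, Φ.segN 0 n ω ^ t
      ≤ Φ.segN 0 m α ^ t * (Φ.K ^ t * Φ.Zr 0 n t / Φ.Zr 0 m t) := by
  have e : ∑ ω : Φ.Word 0 n with Φ.res 0 m le_rfl h ω = α, Φ.segN 0 n ω ^ t
      = ∑ τ : Φ.Word m n, Φ.segN 0 n (Φ.cat α τ) ^ t := by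
    symm
    refine Finset.sum_bij' (fun τ _ => Φ.cat α τ) (fun ω _ => Φ.res m n (Nat.zero_le m) le_rfl ω)
      ?_ ?_ ?_ ?_ ?_
    · intro τ _; simp [res_cat_left]
    · intro ω _; simp
    · intro τ _; simp [res_cat_right]
    · intro ω hω
      simp only [Finset.mem_filter, Finset.mem_univ, true_and] at hω
      rw [← hω]; exact Φ.cat_res _ _ ω
    · intro τ _; rfl
  rw [e]
  refine (Φ.cyl_le h ht α).trans ?_
  refine mul_le_mul_of_nonneg_left ?_ (Real.rpow_nonneg (Φ.segN_pos _ _ _).le t)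
  rw [le_div_iff₀ (Φ.Zr_pos 0 m t), mul_comm]
  exact Φ.Zr_mul_le h ht

end Helpers

section Geometry

variable {d : ℕ} (Φ : NCIFS d)

instance haarHausdorff (d : ℕ) :
    Measure.IsAddHaarMeasure (Measure.hausdorffMeasure (X := EuclideanSpace ℝ (Fin d)) (d : ℝ)) := by
  have := isAddHaarMeasure_hausdorffMeasure (E := EuclideanSpace ℝ (Fin d))
  rwa [finrank_euclideanSpace_fin] at this

/-- Reference volume. -/
abbrev vol (d : ℕ) : Measure (EuclideanSpace ℝ (Fin d)) := Measure.hausdorffMeasure (d : ℝ)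

lemma lipOn (m n : ℕ) (ω : Φ.Word m n) :
    LipschitzOnWith (Real.toNNReal (Φ.segN m n ω)) (Φ.wMap m n ω) Φ.X := by
  refine LipschitzOnWith.of_dist_le_mul fun x hx y hy => ?_
  rw [Real.coe_toNNReal _ (Φ.segN_pos _ _ _).le]
  exact Φ.wMap_lip m n ω x hx y hy

lemma null_image (m n : ℕ) (ω : Φ.Word m n) {s : Set (EuclideanSpace ℝ (Fin d))} (hs : s ⊆ Φ.X)
    (h0 : vol d s = 0) : vol d (Φ.wMap m n ω '' s) = 0 := by
  have := ((Φ.lipOn m n ω).mono hs).hausdorffMeasure_image_le (d := (d : ℝ)) (Nat.cast_nonneg d)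
  rw [show Measure.hausdorffMeasure (d : ℝ) s = 0 from h0, mul_zero] at this
  exact le_antisymm this (zero_le)

lemma injOn (m n : ℕ) (ω : Φ.Word m n) : InjOn (Φ.wMap m n ω) Φ.X := by
  intro x hx y hy hxy
  have h := Φ.wMap_colip m n ω x hx y hy
  rw [hxy, dist_self] at h
  have hp : 0 < Φ.segN m n ω / Φ.K := div_pos (Φ.segN_pos _ _ _) (zero_lt_one.trans_le Φ.hK)
  have : dist x y ≤ 0 := by
    by_contra hc
    push Not at hc
    nlinarith [mul_pos hp hc]
  exact dist_le_zero.1 this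

lemma vol_image_ge (m n : ℕ) (ω : Φ.Word m n) {s : Set (EuclideanSpace ℝ (Fin d))}
    (hs : s ⊆ Φ.X) :
    vol d s ≤ ENNReal.ofReal ((Φ.K / Φ.segN m n ω) ^ d) * vol d (Φ.wMap m n ω '' s) := by
  have hK : 0 < Φ.K := zero_lt_one.trans_le Φ.hK
  have hp : 0 < Φ.segN m n ω := Φ.segN_pos _ _ _
  have hinj := (Φ.injOn m n ω).mono hs
  have hl : LipschitzOnWith (Real.toNNReal (Φ.K / Φ.segN m n ω))
      (Function.invFunOn (Φ.wMap m n ω) s) (Φ.wMap m n ω '' s) := by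
    refine LipschitzOnWith.of_dist_le_mul ?_
    rintro _ ⟨x, hx, rfl⟩ _ ⟨y, hy, rfl⟩
    rw [Real.coe_toNNReal _ (div_pos hK hp).le, hinj.leftInvOn_invFunOn hx,
      hinj.leftInvOn_invFunOn hy]
    have h := Φ.wMap_colip m n ω x (hs hx) y (hs hy)
    rw [div_mul_eq_mul_div, div_le_iff₀ hK] at h
    rw [div_mul_eq_mul_div, le_div_iff₀ hp]
    linarith
  have := hl.hausdorffMeasure_image_le (d := (d : ℝ)) (Nat.cast_nonneg d)
  rw [hinj.leftInvOn_invFunOn.image_image] at this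
  refine this.trans_eq ?_
  rw [ENNReal.rpow_natCast, ENNReal.ofReal_pow (div_pos hK hp).le]
  rfl

lemma X_eq : Φ.X = interior Φ.X ∪ frontier Φ.X := by
  have := Φ.hX_compact.isClosed
  rw [this.frontier_eq]
  exact (union_sdiff_cancel interior_subset).symm

lemma letter_null (n : ℕ) (a b : Φ.Word n (n+1)) (hab : a ≠ b) :
    vol d (Φ.wMap n (n+1) a '' Φ.X ∩ Φ.wMap n (n+1) b '' Φ.X) = 0 := by
  have hf : vol d (frontier Φ.X) = 0 := Φ.hX_convex.addHaar_frontier _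
  have hfX : frontier Φ.X ⊆ Φ.X := Φ.hX_compact.isClosed.frontier_subset
  refine measure_mono_null (t := Φ.wMap n (n+1) a '' frontier Φ.X ∪
    Φ.wMap n (n+1) b '' frontier Φ.X) ?_
    (measure_union_null (Φ.null_image _ _ a hfX hf) (Φ.null_image _ _ b hfX hf))
  rintro z ⟨⟨x, hx, rfl⟩, ⟨y, hy, hxy⟩⟩
  rw [X_eq] at hx hy
  rcases hx with hx | hx
  · rcases hy with hy | hy
    · exact absurd ⟨y, hy, hxy⟩ (disjoint_left.1 (Φ.osc n a b hab) (mem_image_of_mem _ hx))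
    · exact Or.inr ⟨y, hy, hxy⟩
  · exact Or.inl ⟨x, hx, rfl⟩

lemma word_null (n : ℕ) : ∀ (ω τ : Φ.Word 0 n), ω ≠ τ →
    vol d (Φ.wMap 0 n ω '' Φ.X ∩ Φ.wMap 0 n τ '' Φ.X) = 0 := by
  induction n with
  | zero =>
    intro ω τ h
    exact absurd (funext fun j => by have := Finset.mem_Ico.1 j.2; omega) h
  | succ n ih =>
    intro ω τ h
    have h0 : 0 ≤ n := Nat.zero_le n
    have h1 : n ≤ n + 1 := Nat.le_succ n
    by_cases hp : Φ.res 0 n le_rfl h1 ω = Φ.res 0 n le_rfl h1 τ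
    · have hl : Φ.res n (n+1) h0 le_rfl ω ≠ Φ.res n (n+1) h0 le_rfl τ := by
        intro hl
        apply h
        rw [← Φ.cat_res h0 h1 ω, ← Φ.cat_res h0 h1 τ, hp, hl]
      have hnull := Φ.letter_null n _ _ hl
      refine measure_mono_null ?_ (Φ.null_image 0 n (Φ.res 0 n le_rfl h1 ω) ?_ hnull)
      · rintro z ⟨⟨x, hx, rfl⟩, ⟨y, hy, hxy⟩⟩
        rw [Φ.res_comp n h0 h1 ω hx] at hxy ⊢
        rw [Φ.res_comp n h0 h1 τ hy, ← hp] at hxy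
        have := Φ.injOn _ _ _ (Φ.wMap_mapsTo _ _ _ hy) (Φ.wMap_mapsTo _ _ _ hx) hxy
        exact mem_image_of_mem _ ⟨mem_image_of_mem _ hx, ⟨y, hy, this⟩⟩
      · rintro z ⟨⟨x, hx, rfl⟩, -⟩
        exact Φ.wMap_mapsTo _ _ _ hx
    · exact measure_mono_null (inter_subset_inter (Φ.image_res_subset n h0 h1 ω)
        (Φ.image_res_subset n h0 h1 τ)) (ih _ _ hp)

lemma isCompact_image (m n : ℕ) (ω : Φ.Word m n) : IsCompact (Φ.wMap m n ω '' Φ.X) :=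
  Φ.hX_compact.image_of_continuousOn (Φ.lipOn m n ω).continuousOn

lemma vol_X_pos : 0 < vol d Φ.X := by
  have : (interior Φ.X).Nonempty := by
    rw [← closure_nonempty_iff, Φ.hX_regular]; exact Φ.hX_nonempty
  exact Measure.measure_pos_of_nonempty_interior _ this

/-- Uniform fatness of the pieces. -/
lemma fat : ∃ c : ℝ, 0 < c ∧ ∀ (n : ℕ) (ω : Φ.Word 0 n) (x : EuclideanSpace ℝ (Fin d)) (r : ℝ),
    0 < r → r ≤ Φ.segN 0 n ω → (Φ.wMap 0 n ω '' Φ.X ∩ closedBall x r).Nonempty →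
    ENNReal.ofReal (c * r ^ d) ≤ vol d (Φ.wMap 0 n ω '' Φ.X ∩ closedBall x (2 * r)) := by
  obtain ⟨D, hD1, hD⟩ : ∃ D : ℝ, 1 ≤ D ∧ ∀ x ∈ Φ.X, ∀ y ∈ Φ.X, dist x y ≤ D :=
    ⟨max 1 (diam Φ.X), le_max_left _ _, fun x hx y hy =>
      (dist_le_diam_of_mem Φ.hX_compact.isBounded hx hy).trans (le_max_right _ _)⟩
  have hD0 : 0 < D := zero_lt_one.trans_le hD1
  have hK : 0 < Φ.K := zero_lt_one.trans_le Φ.hK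
  have hfin : vol d Φ.X ≠ ⊤ := Φ.hX_compact.measure_lt_top.ne
  have hV : 0 < (vol d Φ.X).toReal := ENNReal.toReal_pos Φ.vol_X_pos.ne' hfin
  refine ⟨(vol d Φ.X).toReal / (D * Φ.K) ^ d, by positivity, ?_⟩
  rintro n ω x r hr hrs ⟨_, ⟨y, hy, rfl⟩, hyx⟩
  set s := Φ.segN 0 n ω with hs
  have hs0 : 0 < s := Φ.segN_pos _ _ _
  set δ : ℝ := r / s / D with hδ
  have hδ0 : 0 < δ := by positivity
  have hδ1 : δ ≤ 1 := by
    rw [hδ, div_div, div_le_one (by positivity)]; nlinarith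
  set S := AffineMap.homothety y δ '' Φ.X with hS
  have hSX : S ⊆ Φ.X := by
    rintro _ ⟨z, hz, rfl⟩
    rw [AffineMap.homothety_eq_lineMap]
    exact Φ.hX_convex.lineMap_mem hy hz ⟨hδ0.le, hδ1⟩
  have hvS : vol d S = ENNReal.ofReal (δ ^ d) * vol d Φ.X := by
    rw [hS, Measure.addHaar_image_homothety, finrank_euclideanSpace_fin,
      abs_of_pos (by positivity)]
  have hsub : Φ.wMap 0 n ω '' S ⊆ Φ.wMap 0 n ω '' Φ.X ∩ closedBall x (2 * r) := by
    rintro _ ⟨z, hz, rfl⟩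
    refine ⟨mem_image_of_mem _ (hSX hz), ?_⟩
    have hzy : dist z y ≤ δ * D := by
      obtain ⟨w, hw, rfl⟩ := hz
      rw [dist_homothety_center, Real.norm_of_nonneg hδ0.le]
      exact mul_le_mul_of_nonneg_left (hD _ hy _ hw) hδ0.le
    have h1 := Φ.wMap_lip 0 n ω z (hSX hz) y hy
    have h2 : s * (δ * D) = r := by rw [hδ]; field_simp
    have h3 : dist (Φ.wMap 0 n ω z) (Φ.wMap 0 n ω y) ≤ r :=
      h1.trans ((mul_le_mul_of_nonneg_left hzy hs0.le).trans h2.le)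
    rw [mem_closedBall] at hyx ⊢
    linarith [dist_triangle (Φ.wMap 0 n ω z) (Φ.wMap 0 n ω y) x]
  have hge := Φ.vol_image_ge 0 n ω hSX
  rw [hvS, ← hs] at hge
  refine le_trans ?_ (measure_mono hsub)
  have hq : 0 < (Φ.K / s) ^ d := by positivity
  rw [← ENNReal.mul_le_mul_iff_right (a := ENNReal.ofReal ((Φ.K / s) ^ d)) (by simpa using hq)
    ENNReal.ofReal_ne_top]
  refine le_trans (le_of_eq ?_) hge
  conv_rhs => rw [← ENNReal.ofReal_toReal hfin]
  rw [← ENNReal.ofReal_mul hq.le, ← ENNReal.ofReal_mul (by positivity)]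
  congr 1
  rw [hδ]
  simp only [div_pow, mul_pow]
  field_simp

open Classical in
/-- Bounded multiplicity. -/
lemma mult [∀ n, Finite (Φ.I n)] : ∃ C : ℝ, 0 < C ∧
    ∀ (n : ℕ) (x : EuclideanSpace ℝ (Fin d)) (r : ℝ), 0 < r →
    ((Finset.univ.filter fun ω : Φ.Word 0 n =>
      r ≤ Φ.segN 0 n ω ∧ (Φ.wMap 0 n ω '' Φ.X ∩ closedBall x r).Nonempty).card : ℝ) ≤ C := by
  obtain ⟨c, hc, hfat⟩ := Φ.fat
  set V := (vol d (ball 0 1)).toReal with hV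
  have hVfin : vol d (ball 0 1) ≠ ⊤ := measure_ball_lt_top.ne
  refine ⟨2 ^ d * V / c + 1, by positivity, ?_⟩
  intro n x r hr
  set T := Finset.univ.filter fun ω : Φ.Word 0 n =>
      r ≤ Φ.segN 0 n ω ∧ (Φ.wMap 0 n ω '' Φ.X ∩ closedBall x r).Nonempty with hT
  have h1 : (T.card : ℝ≥0∞) * ENNReal.ofReal (c * r ^ d)
      ≤ ∑ ω ∈ T, vol d (Φ.wMap 0 n ω '' Φ.X ∩ closedBall x (2 * r)) := by
    rw [← nsmul_eq_mul]
    refine Finset.card_nsmul_le_sum _ _ _ fun ω hω => ?_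
    simp only [hT, Finset.mem_filter, Finset.mem_univ, true_and] at hω
    exact hfat n ω x r hr hω.1 hω.2
  have h2 : ∑ ω ∈ T, vol d (Φ.wMap 0 n ω '' Φ.X ∩ closedBall x (2 * r))
      = vol d (⋃ ω ∈ T, Φ.wMap 0 n ω '' Φ.X ∩ closedBall x (2 * r)) := by
    rw [measure_biUnion_finset₀]
    · intro ω _ τ _ hne
      exact measure_mono_null (inter_subset_inter inter_subset_left inter_subset_left)
        (Φ.word_null n ω τ hne)
    · intro ω _
      exact ((Φ.isCompact_image 0 n ω).measurableSet.inter
        isClosed_closedBall.measurableSet).nullMeasurableSet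
  have h3 : vol d (⋃ ω ∈ T, Φ.wMap 0 n ω '' Φ.X ∩ closedBall x (2 * r))
      ≤ ENNReal.ofReal ((2 * r) ^ d * V) := by
    refine (measure_mono (iUnion₂_subset fun ω _ => inter_subset_right)).trans (le_of_eq ?_)
    rw [Measure.addHaar_closedBall _ _ (by positivity), finrank_euclideanSpace_fin,
      ENNReal.ofReal_mul (by positivity), hV, ENNReal.ofReal_toReal hVfin]
  have h4 := (h1.trans_eq h2).trans h3
  rw [← ENNReal.ofReal_natCast, ← ENNReal.ofReal_mul (by positivity),
    ENNReal.ofReal_le_ofReal_iff (by positivity)] at h4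
  have hrd : 0 < r ^ d := by positivity
  rw [mul_pow] at h4
  have h5 : (T.card : ℝ) * c ≤ 2 ^ d * V := by
    refine le_of_mul_le_mul_right ?_ hrd
    linarith
  have : (T.card : ℝ) ≤ 2 ^ d * V / c := by rwa [le_div_iff₀ hc]
  linarith

lemma sum_biUnion_le_aux {ι κ : Type} [DecidableEq κ] (g : κ → ℝ) (hg : ∀ k, 0 ≤ g k) (s : Finset ι)
    (f : ι → Finset κ) : ∑ k ∈ s.biUnion f, g k ≤ ∑ i ∈ s, ∑ k ∈ f i, g k := by
  classical
  induction s using Finset.induction_on with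
  | empty => simp
  | insert a s ha ih =>
    rw [Finset.biUnion_insert, Finset.sum_insert ha]
    have := Finset.sum_union_inter (s₁ := f a) (s₂ := s.biUnion f) (f := g)
    have h0 : 0 ≤ ∑ k ∈ f a ∩ s.biUnion f, g k := Finset.sum_nonneg fun k _ => hg k
    linarith

variable [∀ n, Finite (Φ.I n)]

open Classical in
/-- Mass of a ball. -/
lemma ball_sum : ∃ C : ℝ, 0 < C ∧ ∀ (t : ℝ), 0 ≤ t →
    ∀ (n : ℕ) (x : EuclideanSpace ℝ (Fin d)) (r : ℝ), 0 < r → r ≤ 1 → Φ.η ^ n < r →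
    ∑ ω : Φ.Word 0 n with (Φ.wMap 0 n ω '' Φ.X ∩ closedBall x r).Nonempty, Φ.segN 0 n ω ^ t
      ≤ C * Φ.K ^ t * r ^ t * Φ.Zr 0 n t *
        ∑ k ∈ Finset.range n, (Nat.card (Φ.I k) : ℝ) / Φ.Zr 0 (k+1) t := by
  obtain ⟨C, hC, hmult⟩ := Φ.mult
  refine ⟨C, hC, ?_⟩
  intro t ht n x r hr hr1 hn
  have hKt : 0 ≤ Φ.K ^ t := Real.rpow_nonneg (zero_le_one.trans Φ.hK) t
  -- the stopping words
  let S : (k : ℕ) → Finset (Φ.Word 0 k) := fun k => Finset.univ.filter fun ω : Φ.Word 0 k =>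
      r ≤ Φ.segN 0 k ω ∧ (Φ.wMap 0 k ω '' Φ.X ∩ closedBall x r).Nonempty
  let T : (k : ℕ) → Finset (Φ.Word 0 (k+1)) := fun k => Finset.univ.filter fun β =>
      Φ.segN 0 (k+1) β < r ∧ Φ.res 0 k le_rfl (Nat.le_succ k) β ∈ S k
  have hTcard : ∀ k, ((T k).card : ℝ) ≤ C * Nat.card (Φ.I k) := by
    intro k
    have : Fintype (Φ.I k) := Fintype.ofFinite _
    have h1 : (T k).card ≤ (S k ×ˢ (Finset.univ : Finset (Φ.I k))).card := by
      refine Finset.card_le_card_of_injOn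
        (fun β => (Φ.res 0 k le_rfl (Nat.le_succ k) β, β ⟨k, by simp⟩)) ?_ ?_
      · intro β hβ
        simp only [T, Finset.coe_filter, Finset.mem_univ, true_and, mem_ofPred_eq] at hβ
        simp [hβ.2]
      · intro β _ γ _ h
        simp only [Prod.mk.injEq] at h
        funext ⟨j, hj⟩
        have hj' := Finset.mem_Ico.1 hj
        rcases Nat.lt_succ_iff_lt_or_eq.1 hj'.2 with h' | h'
        · exact congrFun h.1 ⟨j, by simpa using h'⟩
        · subst h'; exact h.2
    rw [Finset.card_product, Finset.card_univ, ← Nat.card_eq_fintype_card] at h1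
    calc ((T k).card : ℝ) ≤ ((S k).card : ℝ) * Nat.card (Φ.I k) := by exact_mod_cast h1
      _ ≤ _ := mul_le_mul_of_nonneg_right (hmult k x r hr) (Nat.cast_nonneg _)
  -- cylinders
  let Cy : (k : ℕ) → Φ.Word 0 (k+1) → Finset (Φ.Word 0 n) := fun k β =>
    if h : k + 1 ≤ n then Finset.univ.filter fun ω => Φ.res 0 (k+1) le_rfl h ω = β else ∅
  have hcover : (Finset.univ.filter fun ω : Φ.Word 0 n =>
      (Φ.wMap 0 n ω '' Φ.X ∩ closedBall x r).Nonempty)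
      ⊆ (Finset.range n).biUnion fun k => (T k).biUnion fun β => Cy k β := by
    intro ω hω
    simp only [Finset.mem_filter, Finset.mem_univ, true_and] at hω
    have hex : ∃ m, ∃ h : m ≤ n, Φ.segN 0 m (Φ.res 0 m le_rfl h ω) < r :=
      ⟨n, le_rfl, (Φ.segN_contract 0 n ω).trans_lt (by simpa using hn)⟩
    obtain ⟨hmn, hmr⟩ := Nat.find_spec hex
    have hmin := fun k => Nat.find_min hex (m := k)
    generalize Nat.find hex = m at hmn hmr hmin
    cases m with
    | zero =>
      exact absurd hmr (not_lt.2 (hr1.trans (Φ.segN_empty 0 _)))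
    | succ k =>
      simp only [Finset.mem_biUnion, Finset.mem_range]
      refine ⟨k, hmn, Φ.res 0 (k+1) le_rfl hmn ω, ?_, ?_⟩
      · have hk := hmin k (Nat.lt_succ_self k)
        have hkn : k ≤ n := (Nat.le_succ k).trans hmn
        simp only [T, S, Finset.mem_filter, Finset.mem_univ, true_and]
        refine ⟨hmr, ?_, ?_⟩
        · by_contra hc
          exact hk ⟨hkn, not_le.1 hc⟩
        · exact hω.mono (inter_subset_inter_left _ (Φ.image_res_subset k (Nat.zero_le k) hkn ω))
      · simp only [Cy, dif_pos hmn, Finset.mem_filter, Finset.mem_univ, true_and]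
  have hnn : ∀ ω : Φ.Word 0 n, 0 ≤ Φ.segN 0 n ω ^ t :=
    fun ω => Real.rpow_nonneg (Φ.segN_pos _ _ _).le t
  have hsub : ∀ {ι : Type} (s : Finset ι) (f : ι → Finset (Φ.Word 0 n)),
      ∑ ω ∈ s.biUnion f, Φ.segN 0 n ω ^ t ≤ ∑ i ∈ s, ∑ ω ∈ f i, Φ.segN 0 n ω ^ t := by
    intro ι s f
    exact sum_biUnion_le_aux _ hnn s f
  refine (Finset.sum_le_sum_of_subset_of_nonneg hcover fun ω _ _ => hnn ω).trans ?_
  refine (hsub _ _).trans ?_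
  rw [Finset.mul_sum]
  refine Finset.sum_le_sum fun k hk => ?_
  have hkn : k + 1 ≤ n := Finset.mem_range.1 hk
  refine (hsub _ _).trans ?_
  have hZn := Φ.Zr_pos 0 n t
  have hZk := Φ.Zr_pos 0 (k+1) t
  have hrt : 0 ≤ r ^ t := Real.rpow_nonneg hr.le t
  have hb : ∀ β ∈ T k, ∑ ω ∈ Cy k β, Φ.segN 0 n ω ^ t
      ≤ r ^ t * (Φ.K ^ t * Φ.Zr 0 n t / Φ.Zr 0 (k+1) t) := by
    intro β hβ
    simp only [T, Finset.mem_filter, Finset.mem_univ, true_and] at hβ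
    simp only [Cy, dif_pos hkn]
    refine (Φ.cyl_bound hkn ht β).trans ?_
    refine mul_le_mul_of_nonneg_right ?_ (by positivity)
    exact Real.rpow_le_rpow (Φ.segN_pos _ _ _).le hβ.1.le ht
  refine (Finset.sum_le_card_nsmul _ _ _ hb).trans ?_
  rw [nsmul_eq_mul]
  refine (mul_le_mul_of_nonneg_right (hTcard k) (by positivity)).trans (le_of_eq ?_)
  ring

lemma summable_aux (hsub : Tendsto (fun n : ℕ => Real.log (Nat.card (Φ.I n)) / n) atTop (𝓝 0))
    {t : ℝ} (ht : (0 : EReal) < Φ.lowP t) :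
    Summable fun k : ℕ => (Nat.card (Φ.I k) : ℝ) / Φ.Zr 0 (k+1) t := by
  obtain ⟨ε, hε0, hε⟩ := EReal.lt_iff_exists_real_btwn.1 ht
  have hε0' : 0 < ε := by exact_mod_cast hε0
  have hev := eventually_lt_of_lt_liminf hε
  have hev1 : ∀ᶠ k : ℕ in atTop, Real.exp (ε * (k + 1)) ≤ Φ.Zr 0 (k+1) t := by
    have := (tendsto_add_atTop_nat 1).eventually hev
    filter_upwards [this] with k hk
    rw [Z_log, EReal.coe_lt_coe_iff, ← div_eq_mul_inv, lt_div_iff₀ (by positivity)] at hk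
    rw [← Real.le_log_iff_exp_le (Φ.Zr_pos _ _ _)]
    push_cast at hk
    exact hk.le
  have hev2 : ∀ᶠ k : ℕ in atTop, (Nat.card (Φ.I k) : ℝ) ≤ Real.exp (ε / 2 * k) := by
    have := hsub.eventually (gt_mem_nhds (half_pos hε0'))
    filter_upwards [this, eventually_gt_atTop 0] with k hk hk0
    have hk0' : (0 : ℝ) < k := by exact_mod_cast hk0
    have := Φ.hI_ne k
    have hc : (0 : ℝ) < Nat.card (Φ.I k) := by exact_mod_cast Nat.card_pos
    rw [div_lt_iff₀ hk0'] at hk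
    rw [← Real.log_le_iff_le_exp hc]
    exact hk.le
  have hg : Summable fun k : ℕ => Real.exp (-(ε / 2)) ^ k :=
    summable_geometric_of_lt_one (Real.exp_pos _).le (by rw [Real.exp_lt_one_iff]; linarith)
  refine Summable.of_norm_bounded_eventually_nat hg ?_
  filter_upwards [hev1, hev2] with k h1 h2
  have hZ := Φ.Zr_pos 0 (k+1) t
  rw [Real.norm_of_nonneg (by positivity)]
  calc (Nat.card (Φ.I k) : ℝ) / Φ.Zr 0 (k+1) t
      ≤ Real.exp (ε / 2 * k) / Real.exp (ε * (k + 1)) :=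
        div_le_div₀ (Real.exp_pos _).le h2 (Real.exp_pos _) h1
    _ = Real.exp (ε / 2 * k - ε * (k + 1)) := (Real.exp_sub _ _).symm
    _ ≤ Real.exp (k * (-(ε / 2))) := Real.exp_le_exp.2 (by nlinarith)
    _ = _ := Real.exp_nat_mul _ _

lemma level_compact (n : ℕ) : IsCompact (⋃ ω : Φ.Word 0 n, Φ.wMap 0 n ω '' Φ.X) :=
  isCompact_iUnion fun ω => Φ.isCompact_image 0 n ω

lemma level_antitone : Antitone fun n => ⋃ ω : Φ.Word 0 n, Φ.wMap 0 n ω '' Φ.X := by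
  intro m n h
  refine iUnion_subset fun ω => ?_
  exact (Φ.image_res_subset m (Nat.zero_le m) h ω).trans (subset_iUnion_of_subset _ subset_rfl)

lemma limitSet_compact : IsCompact Φ.limitSet :=
  (Φ.level_compact 0).of_isClosed_subset
    (isClosed_iInter fun n => (Φ.level_compact n).isClosed) (iInter_subset _ 0)

/-- Covers by small balls from vanishing Hausdorff measure. -/
lemma exists_ball_cover {s : Set (EuclideanSpace ℝ (Fin d))} {t : ℝ} (ht : 0 < t)
    (h0 : Measure.hausdorffMeasure t s = 0) {ε : ℝ} (hε : 0 < ε) :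
    ∃ (x : ℕ → EuclideanSpace ℝ (Fin d)) (r : ℕ → ℝ), (∀ n, 0 < r n ∧ r n ≤ 1) ∧
      s ⊆ ⋃ n, ball (x n) (r n) ∧ ∀ F : Finset ℕ, ∑ i ∈ F, r i ^ t ≤ ε := by
  have hεE : (0 : ℝ≥0∞) < ENNReal.ofReal (ε / 2) := by simpa using hε
  rw [Measure.hausdorffMeasure_apply] at h0
  have h1 : (⨅ (u : ℕ → Set (EuclideanSpace ℝ (Fin d))) (_ : s ⊆ ⋃ n, u n)
      (_ : ∀ n, ediam (u n) ≤ 2⁻¹), ∑' n, ⨆ _ : (u n).Nonempty, ediam (u n) ^ t)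
        < ENNReal.ofReal (ε / 2) := by
    refine lt_of_le_of_lt (le_of_le_of_eq (le_iSup₂_of_le (2⁻¹ : ℝ≥0∞) (by simp) le_rfl) h0) hεE
  simp only [iInf_lt_iff] at h1
  obtain ⟨u, hu, hdiam, hsum⟩ := h1
  obtain ⟨e, he0, hesum⟩ := ENNReal.exists_pos_sum_of_countable hεE.ne' ℕ
  obtain ⟨x0⟩ : Nonempty (EuclideanSpace ℝ (Fin d)) := inferInstance
  have key : ∀ n, ∃ (x : EuclideanSpace ℝ (Fin d)) (r : ℝ), (0 < r ∧ r ≤ 1) ∧ u n ⊆ ball x r ∧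
      ENNReal.ofReal (r ^ t) ≤ (⨆ _ : (u n).Nonempty, ediam (u n) ^ t) + e n := by
    intro n
    -- general: for a real `a ∈ [0, 1/2]` pick `r > a` close
    have gen : ∀ a : ℝ, 0 ≤ a → a ≤ 1/2 → ∃ r : ℝ, a < r ∧ r ≤ 1 ∧ r ^ t ≤ a ^ t + e n := by
      intro a ha ha2
      have hcont : ContinuousAt (fun r : ℝ => r ^ t) a :=
        Real.continuousAt_rpow_const a t (Or.inr ht.le)
      have hlt : a ^ t < a ^ t + e n := lt_add_of_pos_right _ (by exact_mod_cast he0 n)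
      have ev := (hcont.eventually (gt_mem_nhds hlt)).filter_mono
        (nhdsWithin_le_nhds (s := Ioi a))
      have ev2 : ∀ᶠ r in 𝓝[>] a, r < 1 :=
        (gt_mem_nhds (by linarith : a < 1)).filter_mono nhdsWithin_le_nhds
      obtain ⟨r, ⟨hr1, hr2⟩, hr3⟩ := ((ev.and ev2).and self_mem_nhdsWithin).exists
      exact ⟨r, hr3, hr2.le, hr1.le⟩
    rcases (u n).eq_empty_or_nonempty with hemp | hne
    · obtain ⟨r, hr1, hr2, hr3⟩ := gen 0 le_rfl (by norm_num)
      refine ⟨x0, r, ⟨hr1, hr2⟩, by simp [hemp], ?_⟩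
      rw [Real.zero_rpow ht.ne', zero_add] at hr3
      refine le_add_left ?_
      rw [ENNReal.ofReal_le_iff_le_toReal (by simp)]
      simpa using hr3
    · obtain ⟨x, hx⟩ := hne
      have hfin : ediam (u n) ≠ ⊤ := ((hdiam n).trans_lt (by simp)).ne
      have hle : (ediam (u n)).toReal ≤ 1/2 := by
        have := ENNReal.toReal_mono (by simp) (hdiam n)
        simpa using this
      obtain ⟨r, hr1, hr2, hr3⟩ := gen (ediam (u n)).toReal ENNReal.toReal_nonneg hle
      have hr0 : 0 < r := ENNReal.toReal_nonneg.trans_lt hr1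
      refine ⟨x, r, ⟨hr0, hr2⟩, ?_, ?_⟩
      · intro y hy
        rw [mem_ball]
        refine lt_of_le_of_lt ?_ hr1
        rw [dist_edist]
        exact ENNReal.toReal_mono hfin (edist_le_ediam_of_mem hy hx)
      · have : (⨆ _ : (u n).Nonempty, ediam (u n) ^ t) = ediam (u n) ^ t :=
          iSup_pos ⟨x, hx⟩
        rw [this]
        refine (ENNReal.ofReal_le_ofReal hr3).trans ?_
        rw [ENNReal.ofReal_add (by positivity) (by positivity), ENNReal.ofReal_coe_nnreal,
          ← ENNReal.ofReal_rpow_of_nonneg ENNReal.toReal_nonneg ht.le, ENNReal.ofReal_toReal hfin]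
  choose x r hr hur hrt using key
  refine ⟨x, r, hr, hu.trans (iUnion_mono hur), fun F => ?_⟩
  have hnn : ∀ i ∈ F, 0 ≤ r i ^ t := fun i _ => Real.rpow_nonneg (hr i).1.le t
  rw [← ENNReal.ofReal_le_ofReal_iff hε.le, ENNReal.ofReal_sum_of_nonneg hnn]
  calc ∑ i ∈ F, ENNReal.ofReal (r i ^ t)
      ≤ ∑' i, ENNReal.ofReal (r i ^ t) := ENNReal.sum_le_tsum F
    _ ≤ ∑' i, ((⨆ _ : (u i).Nonempty, ediam (u i) ^ t) + (e i : ℝ≥0∞)) :=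
        ENNReal.tsum_le_tsum hrt
    _ = (∑' i, ⨆ _ : (u i).Nonempty, ediam (u i) ^ t) + ∑' i, (e i : ℝ≥0∞) := ENNReal.tsum_add
    _ ≤ ENNReal.ofReal (ε / 2) + ENNReal.ofReal (ε / 2) := add_le_add hsum.le hesum.le
    _ = ENNReal.ofReal ε := by
        rw [← ENNReal.ofReal_add (by positivity) (by positivity), add_halves]

open Classical in
lemma lower_bound (hsub : Tendsto (fun n : ℕ => Real.log (Nat.card (Φ.I n)) / n) atTop (𝓝 0))
    {t : ℝ} (ht0 : 0 ≤ t) (ht : (0 : EReal) < Φ.lowP t) :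
    ENNReal.ofReal t ≤ dimH Φ.limitSet := by
  by_contra hcon
  push Not at hcon
  have htpos : 0 < t := by
    have : (0 : ℝ≥0∞) < ENNReal.ofReal t := (zero_le).trans_lt hcon
    simpa using this
  have hH : Measure.hausdorffMeasure t Φ.limitSet = 0 := by
    have := hausdorffMeasure_of_dimH_lt (s := Φ.limitSet) (d := t.toNNReal) hcon
    rwa [Real.coe_toNNReal _ ht0] at this
  obtain ⟨C, hC, hball⟩ := Φ.ball_sum
  have hS := Φ.summable_aux hsub ht
  set σ := ∑' k : ℕ, (Nat.card (Φ.I k) : ℝ) / Φ.Zr 0 (k+1) t with hσ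
  have hterm : ∀ k : ℕ, 0 ≤ (Nat.card (Φ.I k) : ℝ) / Φ.Zr 0 (k+1) t :=
    fun k => div_nonneg (Nat.cast_nonneg _) (Φ.Zr_pos _ _ _).le
  have hσ0 : 0 ≤ σ := tsum_nonneg hterm
  have hKt : 0 < Φ.K ^ t := Real.rpow_pos_of_pos (zero_lt_one.trans_le Φ.hK) t
  set A := C * Φ.K ^ t * σ with hA
  have hA0 : 0 ≤ A := by positivity
  obtain ⟨x, r, hr, hcov, hsum⟩ := exists_ball_cover htpos hH
    (ε := 1 / (2 * (A + 1))) (by positivity)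
  obtain ⟨F, hF⟩ := Φ.limitSet_compact.elim_finite_subcover (fun n => ball (x n) (r n))
    (fun n => isOpen_ball) hcov
  have hUopen : IsOpen (⋃ i ∈ F, ball (x i) (r i)) :=
    isOpen_biUnion fun i _ => isOpen_ball
  obtain ⟨n₀, hn₀⟩ := exists_subset_nhds_of_isCompact
    (V := fun n => ⋃ ω : Φ.Word 0 n, Φ.wMap 0 n ω '' Φ.X)
    (Φ.level_antitone.directed_ge) Φ.level_compact
    (U := ⋃ i ∈ F, ball (x i) (r i)) (fun y hy => hUopen.mem_nhds (hF hy))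
  have hη : ∀ᶠ n : ℕ in atTop, ∀ i ∈ F, Φ.η ^ n < r i := by
    rw [Finset.eventually_all]
    intro i _
    exact (tendsto_pow_atTop_nhds_zero_of_lt_one Φ.hη_pos.le Φ.hη_lt).eventually
      (gt_mem_nhds (hr i).1)
  obtain ⟨n, hn1, hn2⟩ := (hη.and (eventually_ge_atTop n₀)).exists
  have hcover : (Finset.univ : Finset (Φ.Word 0 n)) ⊆ F.biUnion fun i =>
      Finset.univ.filter fun ω : Φ.Word 0 n =>
        (Φ.wMap 0 n ω '' Φ.X ∩ closedBall (x i) (r i)).Nonempty := by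
    intro ω _
    obtain ⟨y, hy⟩ := Φ.hX_nonempty
    have h1 : Φ.wMap 0 n ω y ∈ ⋃ i ∈ F, ball (x i) (r i) :=
      hn₀ (Φ.level_antitone hn2 (mem_iUnion.2 ⟨ω, mem_image_of_mem _ hy⟩))
    simp only [mem_iUnion, exists_prop] at h1
    obtain ⟨i, hi, hb⟩ := h1
    simp only [Finset.mem_biUnion, Finset.mem_filter, Finset.mem_univ, true_and]
    exact ⟨i, hi, _, mem_image_of_mem _ hy, ball_subset_closedBall hb⟩
  have hnn : ∀ ω : Φ.Word 0 n, 0 ≤ Φ.segN 0 n ω ^ t :=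
    fun ω => Real.rpow_nonneg (Φ.segN_pos _ _ _).le t
  have hZ := Φ.Zr_pos 0 n t
  have hfinal : Φ.Zr 0 n t ≤ ∑ i ∈ F, A * Φ.Zr 0 n t * r i ^ t := by
    have h1 : Φ.Zr 0 n t ≤ ∑ i ∈ F,
        ∑ ω : Φ.Word 0 n with (Φ.wMap 0 n ω '' Φ.X ∩ closedBall (x i) (r i)).Nonempty,
          Φ.segN 0 n ω ^ t := by
      refine (Finset.sum_le_sum_of_subset_of_nonneg hcover fun ω _ _ => hnn ω).trans ?_
      exact sum_biUnion_le_aux (fun ω : Φ.Word 0 n => Φ.segN 0 n ω ^ t) hnn F _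
    refine h1.trans (Finset.sum_le_sum fun i hi => ?_)
    refine (hball t ht0 n (x i) (r i) (hr i).1 (hr i).2 (hn1 i hi)).trans ?_
    have h2 : ∑ k ∈ Finset.range n, (Nat.card (Φ.I k) : ℝ) / Φ.Zr 0 (k+1) t ≤ σ :=
      hS.sum_le_tsum _ fun k _ => hterm k
    have h3 : 0 ≤ r i ^ t := Real.rpow_nonneg (hr i).1.le t
    refine (mul_le_mul_of_nonneg_left h2 (by positivity)).trans (le_of_eq ?_)
    rw [hA]; ring
  rw [← Finset.mul_sum] at hfinal
  have h4 := hsum F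
  have h5 : A * Φ.Zr 0 n t * ∑ i ∈ F, r i ^ t ≤ A * Φ.Zr 0 n t * (1 / (2 * (A + 1))) :=
    mul_le_mul_of_nonneg_left h4 (by positivity)
  have h6 : A * (1 / (2 * (A + 1))) < 1 := by
    rw [mul_one_div, div_lt_one (by positivity)]; linarith
  nlinarith

lemma upper_bound {s t : ℝ} (hs : 0 ≤ s) (hst : s < t) (hP : Φ.lowP s ≤ 0) :
    dimH Φ.limitSet ≤ ENNReal.ofReal t := by
  have ht : 0 < t := hs.trans_lt hst
  set D := ediam Φ.X with hD
  have hDfin : D ≠ ⊤ := Φ.hX_compact.isBounded.ediam_ne_top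
  have hdiam : ∀ n (ω : Φ.Word 0 n), ediam (Φ.wMap 0 n ω '' Φ.X)
      ≤ ENNReal.ofReal (Φ.segN 0 n ω) * D := by
    intro n ω
    refine Metric.ediam_le ?_
    rintro _ ⟨x, hx, rfl⟩ _ ⟨y, hy, rfl⟩
    refine (Φ.lipOn 0 n ω hx hy).trans ?_
    exact mul_le_mul_right (Metric.edist_le_ediam_of_mem hx hy) _
  have hlog : Real.log Φ.η < 0 := Real.log_neg Φ.hη_pos Φ.hη_lt
  set δ := (t - s) * (-Real.log Φ.η) with hδ
  have hδ0 : 0 < δ := mul_pos (by linarith) (by linarith)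
  have hfreq : ∃ᶠ n : ℕ in atTop, Φ.Zr 0 n t ≤ 1 := by
    have hlt : Φ.lowP s < (δ : EReal) := hP.trans_lt (by exact_mod_cast hδ0)
    have := frequently_lt_of_liminf_lt (by isBoundedDefault) hlt
    refine (this.and_eventually (eventually_gt_atTop 0)).mono ?_
    rintro n ⟨hn, hn0⟩
    have hn0' : (0 : ℝ) < n := by exact_mod_cast hn0
    rw [Z_log, EReal.coe_lt_coe_iff, ← div_eq_mul_inv, div_lt_iff₀ hn0'] at hn
    have h1 : Φ.Zr 0 n t ≤ Φ.Zr 0 n s * Real.exp (-(δ * n)) := by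
      rw [Zr, Zr, Finset.sum_mul]
      refine Finset.sum_le_sum fun ω _ => ?_
      have hp := Φ.segN_pos 0 n ω
      have h2 : Φ.segN 0 n ω ^ t = Φ.segN 0 n ω ^ s * Φ.segN 0 n ω ^ (t - s) := by
        rw [← Real.rpow_add hp]; congr 1; ring
      rw [h2]
      refine mul_le_mul_of_nonneg_left ?_ (Real.rpow_nonneg hp.le s)
      have h3 : Φ.segN 0 n ω ≤ Real.exp (n * Real.log Φ.η) := by
        rw [Real.exp_nat_mul, Real.exp_log Φ.hη_pos]
        simpa using Φ.segN_contract 0 n ω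
      refine (Real.rpow_le_rpow hp.le h3 (by linarith)).trans (le_of_eq ?_)
      rw [← Real.exp_mul]
      congr 1
      rw [hδ]; ring
    have h4 : Φ.Zr 0 n s ≤ Real.exp (δ * n) :=
      (Real.log_le_iff_le_exp (Φ.Zr_pos _ _ _)).1 hn.le
    refine h1.trans ((mul_le_mul_of_nonneg_right h4 (Real.exp_pos _).le).trans (le_of_eq ?_))
    rw [← Real.exp_add]; simp
  have hmeas : Measure.hausdorffMeasure t Φ.limitSet ≤ D ^ t := by
    refine (Measure.hausdorffMeasure_le_liminf_sum t Φ.limitSet (l := atTop)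
      (fun n : ℕ => ENNReal.ofReal (Φ.η ^ n) * D) ?_
      (fun n (ω : Φ.Word 0 n) => Φ.wMap 0 n ω '' Φ.X) ?_ ?_).trans ?_
    · have h1 : Tendsto (fun n : ℕ => ENNReal.ofReal (Φ.η ^ n)) atTop (𝓝 0) := by
        simpa using ENNReal.tendsto_ofReal
          (tendsto_pow_atTop_nhds_zero_of_lt_one Φ.hη_pos.le Φ.hη_lt)
      simpa using ENNReal.Tendsto.mul_const h1 (Or.inr hDfin)
    · refine Eventually.of_forall fun n ω => (hdiam n ω).trans ?_
      gcongr
      simpa using Φ.segN_contract 0 n ω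
    · exact Eventually.of_forall fun n => iInter_subset _ n
    · refine liminf_le_of_frequently_le' (hfreq.mono fun n hn => ?_)
      calc ∑ ω : Φ.Word 0 n, ediam (Φ.wMap 0 n ω '' Φ.X) ^ t
          ≤ ∑ ω : Φ.Word 0 n, ENNReal.ofReal (Φ.segN 0 n ω ^ t) * D ^ t := by
            refine Finset.sum_le_sum fun ω _ => ?_
            refine (ENNReal.rpow_le_rpow (hdiam n ω) ht.le).trans (le_of_eq ?_)
            rw [ENNReal.mul_rpow_of_nonneg _ _ ht.le,
              ENNReal.ofReal_rpow_of_nonneg (Φ.segN_pos _ _ _).le ht.le]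
        _ = ENNReal.ofReal (Φ.Zr 0 n t) * D ^ t := by
            rw [← Finset.sum_mul, Zr, ENNReal.ofReal_sum_of_nonneg]
            exact fun ω _ => Real.rpow_nonneg (Φ.segN_pos 0 n ω).le t
        _ ≤ 1 * D ^ t := by
            gcongr
            exact ENNReal.ofReal_le_one.2 hn
        _ = D ^ t := one_mul _
  refine dimH_le_of_hausdorffMeasure_ne_top (d := t.toNNReal) ?_
  rw [Real.coe_toNNReal _ ht.le]
  exact (hmeas.trans_lt (ENNReal.rpow_lt_top_of_nonneg ht.le hDfin)).ne

end Geometry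

end NCIFS

/-- (Bowen's formula for weakly balanced, subexponentially bounded systems.)
If a finite NCIFS is subexponentially bounded (`(1/n) log #I^{(n)} → 0`) and weakly balanced
(`(1/n) log ρ_n → 0`), then `HD(J(Φ)) = B(Φ)`. -/
theorem NCIFS.bowen_weakly_balanced {d : ℕ} (Φ : NCIFS d) [∀ n, Finite (Φ.I n)]
    (hsub : Tendsto (fun n : ℕ => Real.log (Nat.card (Φ.I n)) / n) atTop (𝓝 0))
    (hbal : Tendsto (fun n : ℕ => Real.log (Φ.ρ n) / n) atTop (𝓝 0)) :
    dimH Φ.limitSet = Φ.Bdim := by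
  refine le_antisymm ?_ ?_
  · refine le_of_forall_gt_imp_ge_of_dense fun c hc => ?_
    obtain ⟨s, hs1, hs2⟩ := ENNReal.lt_iff_exists_nnreal_btwn.1 hc
    obtain ⟨t, ht1, ht2⟩ := ENNReal.lt_iff_exists_nnreal_btwn.1 hs2
    have hst : (s : ℝ) < t := by exact_mod_cast ht1
    have hP : Φ.lowP s ≤ 0 := by
      by_contra hcon
      push Not at hcon
      have := le_iSup (fun t : {t : ℝ // 0 ≤ t ∧ (0 : EReal) < Φ.lowP t} => ENNReal.ofReal t.1)
        ⟨(s : ℝ), s.2, hcon⟩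
      refine absurd hs1 (not_lt.2 ?_)
      simpa [NCIFS.Bdim] using this
    have := Φ.upper_bound s.2 hst hP
    rw [ENNReal.ofReal_coe_nnreal] at this
    exact this.trans ht2.le
  · exact iSup_le fun t => Φ.lower_bound hsub t.2.1 t.2.2
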